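/- For every z ∈ ℂ³, det M(z) = ‖z‖⁴, where ‖z‖² = |z₁|²+|z₂|²+|z₃|². Consequently, since M is ℝ-linear, det(M(y) − M(z)) = ‖y − z‖⁴ for all y, z ∈ ℂ³; in particular M(y)ξ = M(z)ξ for some ξ ∈ ℂ⁴ ∖ {0} forces y = z. -/

import Mathlib

open Matrix

/-- The skew-symmetric matrix `M(z)`, `z ∈ ℂ³`, representing Clifford multiplication. -/
noncomputable def Mz (z : Fin 3 → ℂ) : Matrix (Fin 4) (Fin 4) ℂ :=
  !![0, -z 2, -z 1, -z 0;
     z 2, 0, -(starRingEnd ℂ) (z 0), (starRingEnd ℂ) (z 1);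
     z 1, (starRingEnd ℂ) (z 0), 0, -(starRingEnd ℂ) (z 2);
     z 0, -(starRingEnd ℂ) (z 1), (starRingEnd ℂ) (z 2), 0]

theorem Mz_sub (y z : Fin 3 → ℂ) : Mz (y - z) = Mz y - Mz z := by
  ext i j
  fin_cases i <;> fin_cases j <;> simp [Mz] <;> ring

theorem det_Mz (z : Fin 3 → ℂ) :
    (Mz z).det = ((∑ i, Complex.normSq (z i) : ℝ) : ℂ) ^ 2 := by
  simp only [Fin.sum_univ_three, Complex.ofReal_add, ← Complex.mul_conj]
  simp [Mz, det_succ_row_zero, Fin.sum_univ_succ, Fin.succAbove]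
  ring

theorem det_Mz_sub (y z : Fin 3 → ℂ) :
    (Mz y - Mz z).det = ((∑ i, Complex.normSq (y i - z i) : ℝ) : ℂ) ^ 2 := by
  rw [← Mz_sub, det_Mz]
  rfl

/-- `det M(z) = ‖z‖⁴`; hence `det(M(y) − M(z)) = ‖y − z‖⁴`, and `M(y)ξ = M(z)ξ` for
some `ξ ≠ 0` forces `y = z`. -/
theorem Mz_det :
    (∀ z : Fin 3 → ℂ, (Mz z).det = ((∑ i, Complex.normSq (z i) : ℝ) : ℂ) ^ 2) ∧
    (∀ y z : Fin 3 → ℂ,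
      (Mz y - Mz z).det = ((∑ i, Complex.normSq (y i - z i) : ℝ) : ℂ) ^ 2) ∧
    (∀ (y z : Fin 3 → ℂ) (ξ : Fin 4 → ℂ), ξ ≠ 0 →
      (Mz y).mulVec ξ = (Mz z).mulVec ξ → y = z) := by
  refine ⟨det_Mz, det_Mz_sub, fun y z ξ hξ h => ?_⟩
  have hdet : (Mz y - Mz z).det = 0 :=
    exists_mulVec_eq_zero_iff.mp ⟨ξ, hξ, by rw [sub_mulVec, h, sub_self]⟩
  rw [det_Mz_sub, sq_eq_zero_iff, Complex.ofReal_eq_zero,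
    Finset.sum_eq_zero_iff_of_nonneg fun i _ => Complex.normSq_nonneg _] at hdet
  funext i
  exact sub_eq_zero.mp (Complex.normSq_eq_zero.mp (hdet i (Finset.mem_univ i)))
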